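/- arXiv:2409.13127 — 7 statements merged into one kernel-verified Lean document; each statement's English description precedes it below -/
import Mathlib

section
/- Let λ be an irrational real number. If U ⊆ ℂ³ is an open neighborhood of the origin and f : U → ℂ is a holomorphic function such that f(z, z·e^{z·conj(z)}, z·e^{λ·z·conj(z)}) = 0 for all z ∈ ℂ of sufficiently small modulus, then f vanishes identically on some neighborhood of the origin in ℂ³. -/
open Complex

section Regularity

variable {E : Type*} [NormedAddCommGroup E] [NormedSpace ℂ E] [FiniteDimensional ℂ E]

/-- A holomorphic function on an open subset of a finite-dimensional complex space has a locally
bounded derivative. -/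
theorem exists_bound_fderiv_of_differentiableOn {f : E → ℂ} {U : Set E} (hU : IsOpen U)
    (hf : DifferentiableOn ℂ f U) {x₀ : E} (hx₀ : x₀ ∈ U) :
    ∃ ρ > 0, ∃ C, Metric.ball x₀ ρ ⊆ U ∧ ∀ y ∈ Metric.ball x₀ ρ, ‖fderiv ℂ f y‖ ≤ C := by
  have : ProperSpace E := FiniteDimensional.proper ℂ E
  obtain ⟨ε, hε, hεU⟩ := Metric.nhds_basis_closedBall.mem_iff.1 (hU.mem_nhds hx₀)
  obtain ⟨M, hM⟩ := (isCompact_closedBall x₀ ε).exists_bound_of_continuousOn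
    (hf.continuousOn.mono hεU)
  refine ⟨ε / 2, by positivity, (M + M) / (ε / 2),
    ((Metric.ball_subset_ball (by linarith)).trans Metric.ball_subset_closedBall).trans hεU, ?_⟩
  intro y hy
  have hsub : Metric.ball y (ε / 2) ⊆ Metric.closedBall x₀ ε := by
    intro z hz
    rw [Metric.mem_ball] at hy hz
    rw [Metric.mem_closedBall]
    linarith [dist_triangle z y x₀]
  refine norm_fderiv_le_div_of_mapsTo_ball (hf.mono (hsub.trans hεU)) ?_ (by positivity)
  intro z hz
  rw [mem_closedBall_iff_norm]
  exact (norm_sub_le _ _).trans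
    (add_le_add (hM z (hsub hz)) (hM y (hsub (Metric.mem_ball_self (by positivity)))))

/-- Directional derivatives of holomorphic functions are holomorphic. -/
theorem differentiableOn_fderiv_apply {f : E → ℂ} {U : Set E} (hU : IsOpen U)
    (hf : DifferentiableOn ℂ f U) (v : E) :
    DifferentiableOn ℂ (fun x => fderiv ℂ f x v) U := by
  intro x₀ hx₀
  refine DifferentiableAt.differentiableWithinAt ?_
  obtain ⟨ρ, hρ, C, hρU, hC⟩ := exists_bound_fderiv_of_differentiableOn hU hf hx₀
  obtain ⟨r, hr, hrv⟩ : ∃ r > 0, r * ‖v‖ < ρ / 2 := by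
    refine ⟨ρ / 2 / (‖v‖ + 1), by positivity, ?_⟩
    rw [div_mul_eq_mul_div, div_lt_iff₀ (by positivity)]
    nlinarith [norm_nonneg v]
  have hmem : ∀ x ∈ Metric.ball x₀ (ρ / 2), ∀ s : ℂ, ‖s‖ ≤ r → x + s • v ∈ Metric.ball x₀ ρ := by
    intro x hx s hs
    rw [mem_ball_iff_norm] at hx ⊢
    have : ‖s • v‖ ≤ r * ‖v‖ := by rw [norm_smul]; gcongr
    calc ‖x + s • v - x₀‖ = ‖(x - x₀) + s • v‖ := by congr 1; abel
      _ ≤ ‖x - x₀‖ + ‖s • v‖ := norm_add_le _ _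
      _ < ρ := by linarith
  have hcirc : ∀ θ, ‖circleMap 0 r θ‖ ≤ r := fun θ => by simp [abs_of_pos hr]
  set K : ℝ → ℂ := fun θ => deriv (circleMap 0 r) θ * ((circleMap 0 r θ - 0) ^ 2)⁻¹ with hK
  have hKc : Continuous K := by
    have h1 : Continuous fun θ => ((circleMap 0 r θ - 0) ^ 2)⁻¹ := by
      refine Continuous.inv₀ (by fun_prop) fun θ => ?_
      simp [hr.ne']
    have h2 : Continuous (deriv (circleMap 0 r)) := by
      have : deriv (circleMap 0 r) = fun θ => circleMap 0 r θ * I := by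
        ext θ; simp
      rw [this]; fun_prop
    exact h2.mul h1
  have hKn : ∀ θ, ‖K θ‖ ≤ r⁻¹ := by
    intro θ
    simp only [hK, deriv_circleMap, norm_mul, norm_inv, norm_pow, sub_zero, norm_circleMap_zero,
      abs_of_pos hr, Complex.norm_I, mul_one]
    refine le_of_eq ?_
    field_simp
  have hFc : ∀ x ∈ Metric.ball x₀ (ρ / 2),
      Continuous fun θ => K θ • f (x + circleMap 0 r θ • v) := by
    intro x hx
    refine hKc.smul ?_
    exact (hf.continuousOn.mono hρU).comp_continuous (by fun_prop)
      fun θ => hmem x hx _ (hcirc θ)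
  have hball : Metric.ball x₀ (ρ / 2) ∈ nhds x₀ := Metric.ball_mem_nhds _ (by positivity)
  have hint : HasFDerivAt
      (fun x => ∫ θ in (0 : ℝ)..2 * Real.pi, K θ • f (x + circleMap 0 r θ • v))
      (∫ θ in (0 : ℝ)..2 * Real.pi, K θ • fderiv ℂ f (x₀ + circleMap 0 r θ • v)) x₀ := by
    refine intervalIntegral.hasFDerivAt_integral_of_dominated_of_fderiv_le
      (F' := fun x θ => K θ • fderiv ℂ f (x + circleMap 0 r θ • v))
      (bound := fun _ => r⁻¹ * C) hball ?_ ?_ ?_ ?_ ?_ ?_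
    · filter_upwards [hball] with x hx
      exact (hFc x hx).aestronglyMeasurable
    · exact (hFc x₀ (mem_of_mem_nhds hball)).intervalIntegrable _ _
    · borelize E
      borelize (E →L[ℂ] ℂ)
      refine MeasureTheory.AEStronglyMeasurable.smul hKc.aestronglyMeasurable ?_
      refine Measurable.aestronglyMeasurable ?_
      refine (measurable_fderiv ℂ f).comp ?_
      exact Continuous.measurable (by fun_prop)
    · refine Filter.Eventually.of_forall fun θ _ x hx => ?_
      rw [norm_smul]
      exact mul_le_mul (hKn θ) (hC _ (hmem x hx _ (hcirc θ))) (norm_nonneg _) (by positivity)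
    · exact intervalIntegrable_const
    · refine Filter.Eventually.of_forall fun θ _ x hx => ?_
      have hd := (hf.differentiableAt
        (hU.mem_nhds (hρU (hmem x hx _ (hcirc θ))))).hasFDerivAt
      exact ((hasFDerivAt_comp_add_right _).2 hd).const_smul (K θ)
  refine (hint.differentiableAt.const_smul ((2 * Real.pi * I : ℂ)⁻¹)).congr_of_eventuallyEq ?_
  filter_upwards [hball] with x hx
  have hline : Continuous fun s : ℂ => x + s • v := by fun_prop
  have hdl : DifferentiableOn ℂ (fun s : ℂ => f (x + s • v))
      ((fun s : ℂ => x + s • v) ⁻¹' Metric.ball x₀ ρ) :=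
    (hf.mono hρU).comp (by fun_prop) fun _ h => h
  have hcauchy := two_pi_I_inv_smul_circleIntegral_sub_sq_inv_smul_of_differentiable
    (Metric.isOpen_ball.preimage hline) (c := 0) (w₀ := 0) (R := r)
    (fun s hs => hmem x hx s (by simpa using hs)) hdl (Metric.mem_ball_self hr)
  have hxU : x ∈ U := by simpa using hρU (hmem x hx 0 (by simpa using hr.le))
  have hd : HasDerivAt (fun s : ℂ => f (x + s • v)) (fderiv ℂ f x v) 0 := by
    have h1 : HasDerivAt (fun s : ℂ => x + s • v) v 0 := by
      simpa using ((hasDerivAt_id (0 : ℂ)).smul_const v).const_add x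
    have h2 : HasFDerivAt f (fderiv ℂ f x) (x + (0 : ℂ) • v) := by
      simpa using (hf.differentiableAt (hU.mem_nhds hxU)).hasFDerivAt
    exact h2.comp_hasDerivAt (0 : ℂ) h1
  rw [← hd.deriv, ← hcauchy]
  simp only [circleIntegral, hK, smul_eq_mul, mul_assoc, Pi.smul_apply]

/-- Holomorphic functions on open subsets of finite-dimensional complex spaces are smooth. -/
theorem contDiffOn_of_differentiableOn_of_finiteDimensional {f : E → ℂ} {U : Set E}
    (hU : IsOpen U) (hf : DifferentiableOn ℂ f U) (n : ℕ) : ContDiffOn ℂ n f U := by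
  induction n generalizing f with
  | zero => exact contDiffOn_zero.2 hf.continuousOn
  | succ n ih =>
    push_cast
    refine contDiffOn_succ_of_fderiv_apply hf (fun h => ?_) fun v => ?_
    · exact absurd h (by simp)
    · refine (ih (differentiableOn_fderiv_apply hU hf v)).congr fun x hx => ?_
      rw [fderivWithin_of_isOpen hU hx]

/-- The Taylor coefficients of a holomorphic function along a line through the origin are given by
its iterated Fréchet derivatives. -/
theorem iteratedDeriv_comp_smul {f : E → ℂ} {U : Set E} (hU : IsOpen U) (h0 : (0 : E) ∈ U)
    (hf : DifferentiableOn ℂ f U) (v : E) (k : ℕ) :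
    iteratedDeriv k (fun s : ℂ => f (s • v)) 0 = iteratedFDeriv ℂ k f 0 fun _ => v := by
  let g : ℂ →L[ℂ] E := (ContinuousLinearMap.id ℂ ℂ).smulRight v
  have hg : IsOpen (g ⁻¹' U) := hU.preimage g.continuous
  have hg0 : g 0 ∈ U := by simpa using h0
  have h := g.iteratedFDerivWithin_comp_right
    (contDiffOn_of_differentiableOn_of_finiteDimensional hU hf k) hU.uniqueDiffOn
    hg.uniqueDiffOn hg0 le_rfl
  rw [iteratedFDerivWithin_of_isOpen k hg hg0, iteratedFDerivWithin_of_isOpen k hU hg0] at h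
  have hfg : (fun s : ℂ => f (s • v)) = f ∘ g := by ext s; simp [g]
  rw [iteratedDeriv_eq_iteratedFDeriv, hfg, h]
  simp [g]

/-- A holomorphic function all of whose homogeneous Taylor polynomials vanish at the origin
vanishes on every ball of holomorphy around the origin. -/
theorem eqOn_zero_of_iteratedFDeriv_eq_zero {f : E → ℂ} {R : ℝ}
    (hf : DifferentiableOn ℂ f (Metric.ball 0 R))
    (h : ∀ k v, (iteratedFDeriv ℂ k f 0 fun _ => v) = 0) :
    ∀ p ∈ Metric.ball (0 : E) R, f p = 0 := by
  intro p hp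
  have hR : 0 < R := Metric.pos_of_mem_ball hp
  rw [mem_ball_zero_iff] at hp
  obtain ⟨q, hq1, hq⟩ : ∃ q > 1, q * ‖p‖ < R := by
    have hc : Continuous fun q : ℝ => q * ‖p‖ := by fun_prop
    have : ∀ᶠ q in nhdsWithin (1 : ℝ) (Set.Ioi 1), q * ‖p‖ < R :=
      (hc.continuousAt.eventually_lt_const (by simpa using hp)).filter_mono nhdsWithin_le_nhds
    obtain ⟨q, hq, hq1⟩ := (this.and self_mem_nhdsWithin).exists
    exact ⟨q, hq1, hq⟩
  have hd : DifferentiableOn ℂ (fun s : ℂ => f (s • p)) (Metric.ball 0 q) := by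
    refine hf.comp (by fun_prop) fun s hs => ?_
    rw [mem_ball_zero_iff] at hs ⊢
    rw [norm_smul]
    exact (mul_le_mul_of_nonneg_right hs.le (norm_nonneg _)).trans_lt hq
  have ht := taylorSeries_eq_on_ball' (c := 0) (r := q) (z := 1) (by simpa using hq1) hd
  simp only [iteratedDeriv_comp_smul Metric.isOpen_ball (Metric.mem_ball_self hR) hf, h] at ht
  simpa using ht.symm

end Regularity

section Exponentials

/-- Real-frequency exponentials are linearly independent: if an exponential sum vanishes on an
interval then the coefficients sum to zero against any weight depending only on the frequency. -/
theorem sum_mul_eq_zero_of_exp_sum_eq_zero {ι : Type*} [Fintype ι] (μ : ι → ℝ) (a : ι → ℂ)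
    {ε : ℝ} (hε : 0 < ε) (h : ∀ t : ℝ, 0 < t → t < ε → ∑ i, exp ((μ i : ℂ) * t) * a i = 0)
    (w : ι → ℂ) (hw : ∀ i j, μ i = μ j → w i = w j) : ∑ i, w i * a i = 0 := by
  classical
  have hall : ∀ z : ℂ, ∑ i, exp ((μ i : ℂ) * z) * a i = 0 := by
    have han : AnalyticOnNhd ℂ (fun z : ℂ => ∑ i, exp ((μ i : ℂ) * z) * a i) Set.univ :=
      analyticOnNhd_univ_iff_differentiable.2 (by fun_prop)
    have hfreq : ∃ᶠ z in nhdsWithin (0 : ℂ) {0}ᶜ, ∑ i, exp ((μ i : ℂ) * z) * a i = 0 := by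
      have ht : Filter.Tendsto (fun t : ℝ => (t : ℂ)) (nhdsWithin 0 (Set.Ioi 0))
          (nhdsWithin (0 : ℂ) {0}ᶜ) := by
        refine tendsto_nhdsWithin_iff.2 ⟨?_, ?_⟩
        · exact (Complex.continuous_ofReal.tendsto' 0 0 (by simp)).mono_left nhdsWithin_le_nhds
        · filter_upwards [self_mem_nhdsWithin] with t ht
          simpa using (ne_of_gt ht)
      refine ht.frequently (Filter.Eventually.frequently ?_)
      filter_upwards [Ioo_mem_nhdsGT hε] with t ht using h t ht.1 ht.2
    have := han.eqOn_zero_of_preconnected_of_frequently_eq_zero isPreconnected_univ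
      (Set.mem_univ 0) hfreq
    exact fun z => this (Set.mem_univ z)
  let χ : ℝ → (Multiplicative ℂ →* ℂ) := fun c =>
    { toFun := fun z => exp ((c : ℂ) * z.toAdd)
      map_one' := by simp
      map_mul' := fun x y => by simp [mul_add, exp_add] }
  have hχ : Function.Injective χ := by
    intro c d hcd
    have hd : ∀ c : ℝ, HasDerivAt (fun z : ℂ => exp ((c : ℂ) * z)) (c : ℂ) 0 := fun c => by
      simpa using ((hasDerivAt_id (0 : ℂ)).const_mul (c : ℂ)).cexp
    have he : (fun z : ℂ => exp ((c : ℂ) * z)) = fun z : ℂ => exp ((d : ℂ) * z) :=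
      funext fun z => DFunLike.congr_fun hcd (Multiplicative.ofAdd z)
    exact_mod_cast (hd c).unique (he ▸ hd d)
  have hli := (linearIndependent_monoidHom (Multiplicative ℂ) ℂ).comp χ hχ
  have hfib : ∀ c ∈ Finset.univ.image μ, ∑ i with μ i = c, a i = 0 := by
    refine linearIndependent_iff'.1 hli (Finset.univ.image μ)
      (fun c => ∑ i with μ i = c, a i) ?_
    ext z
    rw [Finset.sum_apply, Pi.zero_apply, ← hall z.toAdd,
      ← Finset.sum_fiberwise_of_maps_to (t := Finset.univ.image μ) (g := μ) (by simp)]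
    refine Finset.sum_congr rfl fun c _ => ?_
    rw [Pi.smul_apply, smul_eq_mul, Finset.sum_mul]
    refine Finset.sum_congr rfl fun i hi => ?_
    rw [← (Finset.mem_filter.1 hi).2, mul_comm]
    rfl
  rw [← Finset.sum_fiberwise_of_maps_to (t := Finset.univ.image μ) (g := μ) (by simp)]
  refine Finset.sum_eq_zero fun c hc => ?_
  obtain ⟨j, -, rfl⟩ := Finset.mem_image.1 hc
  rw [Finset.sum_congr rfl fun i hi => by rw [hw i j (Finset.mem_filter.1 hi).2],
    ← Finset.mul_sum, hfib _ hc, mul_zero]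

/-- For irrational `lam`, the sum of the weights `0, 1, lam` over a word in three letters
determines the number of occurrences of each letter. -/
theorem prod_eq_prod_of_sum_eq_sum {lam : ℝ} (hlam : Irrational lam) {k : ℕ}
    (r r' : Fin k → Fin 3)
    (h : ∑ i, (![0, 1, lam] : Fin 3 → ℝ) (r i) = ∑ i, (![0, 1, lam] : Fin 3 → ℝ) (r' i))
    (c : Fin 3 → ℂ) : ∏ i, c (r i) = ∏ i, c (r' i) := by
  have hsum : ∀ r : Fin k → Fin 3, ∑ i, (![0, 1, lam] : Fin 3 → ℝ) (r i) =
      (Finset.card {i | r i = 1} : ℕ) + (Finset.card {i | r i = 2} : ℕ) * lam := fun r => by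
    rw [← Finset.sum_fiberwise Finset.univ r, Fin.sum_univ_three]
    rw [Finset.sum_congr rfl fun i hi => by rw [(Finset.mem_filter.1 hi).2],
      Finset.sum_congr (s₁ := {i | r i = 1}) rfl fun i hi => by rw [(Finset.mem_filter.1 hi).2],
      Finset.sum_congr (s₁ := {i | r i = 2}) rfl fun i hi => by rw [(Finset.mem_filter.1 hi).2]]
    simp
  have hprod : ∀ r : Fin k → Fin 3, ∏ i, c (r i) = c 0 ^ (Finset.card {i | r i = 0}) *
      c 1 ^ (Finset.card {i | r i = 1}) * c 2 ^ (Finset.card {i | r i = 2}) := fun r => by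
    rw [← Finset.prod_fiberwise Finset.univ r, Fin.prod_univ_three]
    congr 1
    · congr 1
      all_goals exact Finset.prod_eq_pow_card fun i hi => by rw [(Finset.mem_filter.1 hi).2]
    · exact Finset.prod_eq_pow_card fun i hi => by rw [(Finset.mem_filter.1 hi).2]
  have hcard : ∀ r : Fin k → Fin 3, Finset.card {i | r i = 0} + Finset.card {i | r i = 1} +
      Finset.card {i | r i = 2} = k := fun r => by
    have := Finset.card_eq_sum_card_fiberwise (s := Finset.univ) (t := Finset.univ) (f := r)
      (by simp)
    rw [Fin.sum_univ_three] at this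
    simpa using this.symm
  rw [hsum, hsum] at h
  have h2 : (Finset.card {i | r i = 2} : ℤ) = Finset.card {i | r' i = 2} := by
    by_contra hne
    refine hlam ⟨((Finset.card {i | r' i = 1} : ℤ) - (Finset.card {i | r i = 1} : ℤ) : ℚ) /
      ((Finset.card {i | r i = 2} : ℤ) - (Finset.card {i | r' i = 2} : ℤ) : ℚ), ?_⟩
    have hne' : ((Finset.card {i | r i = 2} : ℝ) - Finset.card {i | r' i = 2}) ≠ 0 :=
      sub_ne_zero.2 (by exact_mod_cast hne)
    push_cast
    rw [div_eq_iff hne']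
    linarith
  have h2' : Finset.card {i | r i = 2} = Finset.card {i | r' i = 2} := by exact_mod_cast h2
  rw [h2'] at h
  have h1 : Finset.card {i | r i = 1} = Finset.card {i | r' i = 1} := by
    exact_mod_cast add_right_cancel h
  have h0 : Finset.card {i | r i = 0} = Finset.card {i | r' i = 0} := by
    have := hcard r
    have := hcard r'
    omega
  rw [hprod, hprod, h0, h1, h2']

/-- A homogeneous polynomial in three variables vanishing along the curve
`t ↦ (1, exp t, exp (lam * t))` near `t = 0` is zero. -/
theorem multilinear_diag_eq_zero {lam : ℝ} (hlam : Irrational lam) {k : ℕ}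
    (D : MultilinearMap ℂ (fun _ : Fin k => ℂ × ℂ × ℂ) ℂ) {ε : ℝ} (hε : 0 < ε)
    (h : ∀ t : ℝ, 0 < t → t < ε →
      (D fun _ => ((1 : ℂ), exp (t : ℂ), exp ((lam : ℂ) * t))) = 0)
    (v : ℂ × ℂ × ℂ) : (D fun _ => v) = 0 := by
  let e : Fin 3 → ℂ × ℂ × ℂ := ![(1, 0, 0), (0, 1, 0), (0, 0, 1)]
  have hexp : ∀ c : Fin 3 → ℂ, (D fun _ => (c 0, c 1, c 2)) =
      ∑ r : Fin k → Fin 3, (∏ i, c (r i)) * D fun i => e (r i) := fun c => by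
    have hc : (c 0, c 1, c 2) = ∑ j, c j • e j := by
      simp [Fin.sum_univ_three, e]
    rw [hc, D.map_sum (fun _ j => c j • e j)]
    exact Finset.sum_congr rfl fun r _ => D.map_smul_univ _ _
  refine (hexp ![v.1, v.2.1, v.2.2]).trans ?_
  refine sum_mul_eq_zero_of_exp_sum_eq_zero
    (fun r : Fin k → Fin 3 => ∑ i, (![0, 1, lam] : Fin 3 → ℝ) (r i)) _ hε (fun t ht htε => ?_) _
    fun r r' hr => prod_eq_prod_of_sum_eq_sum hlam r r' hr _
  have hcurve := hexp fun j => exp (((![0, 1, lam] : Fin 3 → ℝ) j : ℂ) * t)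
  rw [← h t ht htε]
  convert hcurve.symm using 2
  · rw [← exp_sum]
    push_cast
    rw [Finset.sum_mul]
  · simp

end Exponentials

/-- If `λ` is irrational and `f` is holomorphic near `0 ∈ ℂ³` and vanishes on the
CR singular submanifold `M_λ = {(z, z e^{z z̄}, z e^{λ z z̄})}` near the origin, then `f`
vanishes identically on a neighborhood of the origin. -/
theorem stmt_0 (lam : ℝ) (hlam : Irrational lam)
    (U : Set (ℂ × ℂ × ℂ)) (hU : IsOpen U) (hU0 : ((0 : ℂ), (0 : ℂ), (0 : ℂ)) ∈ U)
    (f : ℂ × ℂ × ℂ → ℂ) (hf : DifferentiableOn ℂ f U)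
    (δ : ℝ) (hδ : 0 < δ)
    (hvan : ∀ z : ℂ, ‖z‖ < δ →
      (z, z * Complex.exp (z * (starRingEnd ℂ) z),
        z * Complex.exp ((lam : ℂ) * (z * (starRingEnd ℂ) z))) ∈ U →
      f (z, z * Complex.exp (z * (starRingEnd ℂ) z),
        z * Complex.exp ((lam : ℂ) * (z * (starRingEnd ℂ) z))) = 0) :
    ∃ V : Set (ℂ × ℂ × ℂ), IsOpen V ∧ ((0 : ℂ), (0 : ℂ), (0 : ℂ)) ∈ V ∧ V ⊆ U ∧
      ∀ p ∈ V, f p = 0 := by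
  have hmem : (0 : ℂ × ℂ × ℂ) ∈ U := hU0
  obtain ⟨R, hR, hRU⟩ := Metric.isOpen_iff.1 hU 0 hmem
  have hfR := hf.mono hRU
  refine ⟨Metric.ball 0 R, Metric.isOpen_ball, Metric.mem_ball_self hR, hRU,
    eqOn_zero_of_iteratedFDeriv_eq_zero hfR fun k v => ?_⟩
  let γ : ℝ → ℂ × ℂ × ℂ := fun t => (1, exp (t : ℂ), exp ((lam : ℂ) * t))
  have hγ : Continuous γ := by fun_prop
  obtain ⟨ε, hε, hεR⟩ : ∃ ε > 0, ∀ t : ℝ, 0 < t → t < ε →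
      √t < δ ∧ √t * ‖γ t‖ < R := by
    have h1 : ∀ᶠ t in nhds (0 : ℝ), √t < δ :=
      Real.continuous_sqrt.continuousAt.eventually_lt_const (by simpa using hδ)
    have h2 : ∀ᶠ t in nhds (0 : ℝ), √t * ‖γ t‖ < R :=
      (Real.continuous_sqrt.mul hγ.norm).continuousAt.eventually_lt_const (by simpa using hR)
    obtain ⟨ε, hε, h⟩ := Metric.eventually_nhds_iff.1 (h1.and h2)
    exact ⟨ε, hε, fun t ht htε => h (by simpa [abs_of_pos ht] using htε)⟩
  refine multilinear_diag_eq_zero hlam (iteratedFDeriv ℂ k f 0).toMultilinearMap hε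
    (fun t ht htε => ?_) v
  obtain ⟨htδ, htR⟩ := hεR t ht htε
  have hsq : 0 < √t := Real.sqrt_pos.2 ht
  have hin : ∀ s ∈ Metric.closedBall (0 : ℂ) √t, s • γ t ∈ Metric.ball 0 R := fun s hs => by
    rw [mem_closedBall_zero_iff] at hs
    rw [mem_ball_zero_iff, norm_smul]
    exact (mul_le_mul_of_nonneg_right hs (norm_nonneg _)).trans_lt htR
  have hcl : DiffContOnCl ℂ (fun s : ℂ => f (s • γ t)) (Metric.ball 0 √t) := by
    refine DifferentiableOn.diffContOnCl ?_
    rw [closure_ball _ hsq.ne']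
    exact hfR.comp (by fun_prop) hin
  have hzero : Set.EqOn (fun s : ℂ => f (s • γ t)) 0 (Metric.ball 0 √t) := by
    refine eqOn_of_eqOn_frontier Metric.isBounded_ball hcl
      (differentiable_const 0).diffContOnCl ?_
    rw [frontier_ball _ hsq.ne']
    intro s hs
    have hsn : ‖s‖ = √t := by simpa using hs
    have hss : s * (starRingEnd ℂ) s = t := by
      rw [mul_conj, normSq_eq_norm_sq, hsn, Real.sq_sqrt ht.le]
    have hpt : s • γ t = (s, s * exp (s * (starRingEnd ℂ) s),
        s * exp ((lam : ℂ) * (s * (starRingEnd ℂ) s))) := by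
      simp [hss, γ]
    have hsU := hRU (hin s (Metric.sphere_subset_closedBall hs))
    simp only [Pi.zero_apply]
    rw [hpt] at hsU ⊢
    exact hvan s (hsn ▸ htδ) hsU
  have hev : (fun s : ℂ => f (s • γ t)) =ᶠ[nhds 0] fun _ => 0 :=
    Filter.eventuallyEq_of_mem (Metric.ball_mem_nhds _ hsq) hzero
  have := iteratedDeriv_comp_smul Metric.isOpen_ball (Metric.mem_ball_self hR) hfR (γ t) k
  rw [hev.iteratedDeriv_eq] at this
  simpa [γ] using this.symm
end

section
/- Let X = {(z, w) ∈ ℂ² : (x² + y²)·s = x³}, where z = x + iy and w = s + it with x, y, s, t real. Then {0} × ℂ ⊆ X, and for every w₀ ∈ ℂ with Re w₀ ≠ 0 there exists an open neighborhood V of (0, w₀) in ℂ² such that X ∩ V = {(z, w) ∈ V : z = 0}. -/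
/-- A point of the umbrella with `|Re z| < |s|` lies on its handle `z = 0`. -/
theorem eq_zero_of_umbrella_of_sq_lt {z : ℂ} {s : ℝ}
    (h : (z.re ^ 2 + z.im ^ 2) * s = z.re ^ 3) (hs : z.re ^ 2 < s ^ 2) : z = 0 := by
  by_contra hz
  have hpos : 0 < z.re ^ 2 + z.im ^ 2 := by
    have := Complex.normSq_pos.mpr hz
    rw [Complex.normSq_apply] at this
    nlinarith
  have hlt : (z.re ^ 2 + z.im ^ 2) ^ 2 * z.re ^ 2 < (z.re ^ 2 + z.im ^ 2) ^ 2 * s ^ 2 :=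
    mul_lt_mul_of_pos_left hs (pow_pos hpos 2)
  have hle : (z.re ^ 2) ^ 2 * z.re ^ 2 ≤ (z.re ^ 2 + z.im ^ 2) ^ 2 * z.re ^ 2 := by
    gcongr
    exact le_add_of_nonneg_right (sq_nonneg _)
  have heq : (z.re ^ 2 + z.im ^ 2) ^ 2 * s ^ 2 = (z.re ^ 2) ^ 2 * z.re ^ 2 := by
    rw [← mul_pow, h]
    ring
  linarith

/-- For the variant of the Cartan umbrella `X = {(x²+y²)s = x³} ⊆ ℂ²`
(where `z = x+iy`, `w = s+it`): the complex line `{0} × ℂ` is contained in `X`, and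
near any point `(0, w₀)` with `Re w₀ ≠ 0` the variety `X` coincides with `{z = 0}`. -/
theorem stmt_4 :
    let X : Set (ℂ × ℂ) :=
      {p : ℂ × ℂ | (p.1.re ^ 2 + p.1.im ^ 2) * p.2.re = p.1.re ^ 3}
    (Set.prod {(0 : ℂ)} (Set.univ : Set ℂ) ⊆ X) ∧
    ∀ w₀ : ℂ, w₀.re ≠ 0 → ∃ V : Set (ℂ × ℂ), IsOpen V ∧ ((0 : ℂ), w₀) ∈ V ∧
      X ∩ V = {p : ℂ × ℂ | p ∈ V ∧ p.1 = 0} := by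
  intro X
  refine ⟨?_, fun w₀ hw₀ => ?_⟩
  · rintro ⟨z, w⟩ ⟨hz, -⟩
    obtain rfl : z = 0 := hz
    simp [X]
  · refine ⟨{p | p.1.re ^ 2 < p.2.re ^ 2}, isOpen_lt (by fun_prop) (by fun_prop), ?_, ?_⟩
    · simpa using sq_pos_of_ne_zero hw₀
    · ext ⟨z, w⟩
      constructor
      · rintro ⟨hX, hV⟩
        exact ⟨hV, eq_zero_of_umbrella_of_sq_lt hX hV⟩
      · rintro ⟨hV, hz⟩
        obtain rfl : z = 0 := hz
        exact ⟨by simp [X], hV⟩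
end

section
/- Let λ be a nonzero real number and define Φ : ℂ → ℂ³ by Φ(z) = (z, z·e^{z·conj(z)}, z·e^{λ·z·conj(z)}). For z₀ ∈ ℂ, let T(z₀) ⊆ ℂ³ be the real span of the two partial derivatives of Φ at z₀ with respect to x = Re z and y = Im z. Then: (a) for every z₀ ≠ 0, T(z₀) is a 2-dimensional real subspace of ℂ³ satisfying T(z₀) ∩ i·T(z₀) = {0} (i.e., M_λ is totally real at Φ(z₀)); and (b) T(0) = ℂ·(1,1,1) is a complex line (i.e., M_λ is CR singular at the origin). -/
open scoped Pointwise ComplexConjugate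

/-- The real differential at `z` of `z ↦ z * exp (c * (z * conj z))`. -/
noncomputable def twistDifferential (c z : ℂ) : ℂ →ₗ[ℝ] ℂ where
  toFun w := Complex.exp (c * (z * conj z)) * (w + z * (c * (w * conj z + z * conj w)))
  map_add' v w := by simp only [map_add]; ring
  map_smul' r w := by
    simp only [Complex.real_smul, map_mul, Complex.conj_ofReal, RingHom.id_apply]; ring

theorem hasDerivAt_twist (c z w : ℂ) :
    HasDerivAt (fun t : ℝ => (z + t * w) *
      Complex.exp (c * ((z + t * w) * conj (z + t * w)))) (twistDifferential c z w) 0 := by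
  have hl (u v : ℂ) : HasDerivAt (fun t : ℝ => u + (t : ℂ) * v) v 0 := by
    simpa using ((Complex.ofRealCLM.hasDerivAt (x := (0 : ℝ))).mul_const v).const_add u
  have h := (hl z w).mul ((((hl z w).mul (hl (conj z) (conj w))).const_mul c).cexp)
  refine (h.congr_deriv ?_).congr_of_eventuallyEq (.of_forall fun t => ?_)
  · simp [twistDifferential]
    ring
  · simp

/-- The real differential at `z` of
`z ↦ (z, z * exp (z * conj z), z * exp (lam * (z * conj z)))`. -/
noncomputable def surfaceDifferential (lam : ℝ) (z : ℂ) : ℂ →ₗ[ℝ] ℂ × ℂ × ℂ :=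
  LinearMap.id.prod ((twistDifferential 1 z).prod (twistDifferential lam z))

theorem surfaceDifferential_apply (lam : ℝ) (z w : ℂ) :
    surfaceDifferential lam z w = (w, twistDifferential 1 z w, twistDifferential lam z w) :=
  rfl

theorem hasDerivAt_surface (lam : ℝ) (z w : ℂ) :
    HasDerivAt (fun t : ℝ => (z + t * w,
      (z + t * w) * Complex.exp ((z + t * w) * conj (z + t * w)),
      (z + t * w) * Complex.exp (lam * ((z + t * w) * conj (z + t * w)))))
      (surfaceDifferential lam z w) 0 := by
  have h0 : HasDerivAt (fun t : ℝ => z + (t : ℂ) * w) w 0 := by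
    simpa using ((Complex.ofRealCLM.hasDerivAt (x := (0 : ℝ))).mul_const w).const_add z
  have h1 := hasDerivAt_twist 1 z w
  simp only [one_mul] at h1
  exact h0.prodMk (h1.prodMk (hasDerivAt_twist lam z w))

theorem surfaceDifferential_injective (lam : ℝ) (z : ℂ) :
    Function.Injective (surfaceDifferential lam z) :=
  fun _ _ h => congrArg Prod.fst h

theorem span_surfaceDifferential (lam : ℝ) (z : ℂ) :
    Submodule.span ℝ {surfaceDifferential lam z 1, surfaceDifferential lam z Complex.I} =
      (surfaceDifferential lam z).range := by
  ext v
  simp only [Submodule.mem_span_pair, LinearMap.mem_range, ← map_smul, ← map_add]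
  constructor
  · rintro ⟨a, b, h⟩
    exact ⟨_, h⟩
  · rintro ⟨w, h⟩
    refine ⟨w.re, w.im, ?_⟩
    rw [← h]
    congr 1
    simp [Complex.re_add_im]

theorem eq_zero_of_twistDifferential_eq {z w : ℂ} (hz : z ≠ 0)
    (h : twistDifferential 1 z (Complex.I * w) = Complex.I * twistDifferential 1 z w) :
    w = 0 := by
  have hE : Complex.exp (1 * (z * conj z)) * (z * z * conj w) = 0 := by
    simp only [twistDifferential, LinearMap.coe_mk, AddHom.coe_mk, map_mul, Complex.conj_I] at h
    linear_combination (Complex.I / 2) * h +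
      Complex.exp (1 * (z * conj z)) * (z * z * conj w) * Complex.I_sq
  simpa [hz, Complex.exp_ne_zero] using hE

open scoped Pointwise

/-- For `λ ≠ 0`, the submanifold `M_λ = Φ(ℂ)` with
`Φ(z) = (z, z e^{z z̄}, z e^{λ z z̄})` is totally real at every point `Φ(z₀)`, `z₀ ≠ 0`
(its tangent space `T(z₀)` is 2-dimensional with `T(z₀) ∩ i T(z₀) = {0}`),
while at the origin the tangent space is the complex line `ℂ·(1,1,1)`. -/
theorem stmt_6 (lam : ℝ) (hlam : lam ≠ 0) :
    let Φ : ℂ → ℂ × ℂ × ℂ := fun z =>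
      (z, z * Complex.exp (z * (starRingEnd ℂ) z),
        z * Complex.exp ((lam : ℂ) * (z * (starRingEnd ℂ) z)))
    let T : ℂ → Submodule ℝ (ℂ × ℂ × ℂ) := fun z₀ =>
      Submodule.span ℝ
        {deriv (fun t : ℝ => Φ (z₀ + (t : ℂ))) 0,
         deriv (fun t : ℝ => Φ (z₀ + (t : ℂ) * Complex.I)) 0}
    (∀ z₀ : ℂ, z₀ ≠ 0 →
      Module.finrank ℝ (T z₀) = 2 ∧
      ((T z₀ : Set (ℂ × ℂ × ℂ)) ∩ (Complex.I • (T z₀ : Set (ℂ × ℂ × ℂ))) = {0})) ∧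
    ((T 0 : Set (ℂ × ℂ × ℂ)) = {v : ℂ × ℂ × ℂ | ∃ c : ℂ, v = (c, c, c)}) := by
  intro Φ T
  have hT (z : ℂ) : T z = (surfaceDifferential lam z).range := by
    have h1 := (hasDerivAt_surface lam z 1).deriv
    simp only [mul_one] at h1
    have hI := (hasDerivAt_surface lam z Complex.I).deriv
    rw [← span_surfaceDifferential, ← h1, ← hI]
  refine ⟨fun z hz => ⟨?_, ?_⟩, ?_⟩
  · rw [hT, LinearMap.finrank_range_of_inj (surfaceDifferential_injective lam z),
      Complex.finrank_real_complex]
  · rw [hT]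
    refine Set.Subset.antisymm ?_ ?_
    · rintro _ ⟨⟨v, rfl⟩, _, ⟨w, rfl⟩, h⟩
      simp only [surfaceDifferential_apply, Prod.smul_mk, smul_eq_mul, Prod.mk.injEq] at h
      obtain ⟨rfl, h, -⟩ := h
      simp [eq_zero_of_twistDifferential_eq hz h.symm]
    · rintro _ rfl
      exact ⟨zero_mem _, 0, zero_mem _, smul_zero _⟩
  · rw [hT]
    ext v
    simp [surfaceDifferential_apply, twistDifferential, eq_comm]
end

section
/- The polynomial q(z₁, z₂) = (z₁ − 1)·z₁² + z₂² is irreducible in the polynomial ring ℂ[z₁, z₂]. -/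
open MvPolynomial

/-- A square in `ℂ[t]` has even degree, so it is never the cubic `-(t - 1)t²`. -/
lemma Polynomial.sub_one_mul_sq_add_sq_ne_zero (p : Polynomial ℂ) :
    (Polynomial.X - 1) * Polynomial.X ^ 2 + p ^ 2 ≠ 0 := by
  intro h
  have hcubic : ((Polynomial.X - 1) * Polynomial.X ^ 2 : Polynomial ℂ).natDegree = 3 := by
    rw [← Polynomial.C_1, Polynomial.natDegree_mul (Polynomial.X_sub_C_ne_zero 1) (by simp),
      Polynomial.natDegree_X_sub_C, Polynomial.natDegree_X_pow]
  rw [eq_neg_of_add_eq_zero_left h, Polynomial.natDegree_neg, Polynomial.natDegree_pow] at hcubic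
  omega

/-- The polynomial `(z₁ − 1)z₁² + z₂²` is irreducible in `ℂ[z₁, z₂]`. -/
theorem stmt_7 :
    Irreducible (((X 0 - 1) * (X 0) ^ 2 + (X 1) ^ 2 : MvPolynomial (Fin 2) ℂ)) := by
  let e := (renameEquiv ℂ (Equiv.swap (0 : Fin 2) 1)).trans (finSuccEquiv ℂ 1)
  rw [← MulEquiv.irreducible_iff e]
  set a : MvPolynomial (Fin 1) ℂ := (X 0 - 1) * X 0 ^ 2 with ha
  have he : e ((X 0 - 1) * X 0 ^ 2 + X 1 ^ 2) = Polynomial.X ^ 2 + Polynomial.C a := by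
    have h1 : finSuccEquiv ℂ 1 (X 1) = Polynomial.C (X 0) := finSuccEquiv_X_succ (j := 0)
    simp [e, ha, h1, finSuccEquiv_X_zero, add_comm]
  have hdeg : (Polynomial.X ^ 2 + Polynomial.C a).natDegree = 2 :=
    Polynomial.natDegree_X_pow_add_C
  have hmonic : (Polynomial.X ^ 2 + Polynomial.C a).Monic :=
    Polynomial.monic_X_pow_add_C a two_ne_zero
  rw [he, hmonic.irreducible_iff_roots_eq_zero_of_degree_le_three hdeg.ge (by omega),
    Multiset.eq_zero_iff_forall_notMem]
  intro r hr
  have hroot : r ^ 2 + a = 0 := by simpa using Polynomial.isRoot_of_mem_roots hr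
  apply Polynomial.sub_one_mul_sq_add_sq_ne_zero (aeval (fun _ => Polynomial.X) r)
  simpa [ha, add_comm] using congrArg (aeval fun _ => (Polynomial.X : Polynomial ℂ)) hroot
end

section
/- If U ⊆ ℂ³ is an open neighborhood of the origin and f : U → ℂ is a holomorphic function such that f(z, |z|⁴, |z|⁶) = 0 for all z ∈ ℂ of sufficiently small modulus (where |z|⁴ and |z|⁶ are viewed as complex numbers with zero imaginary part), then f vanishes on {(z, w₁, w₂) ∈ ℂ³ : w₁³ = w₂²} in some neighborhood of the origin. -/
/-- A holomorphic function `g` of one variable on a disc which vanishes on a real segment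
`(a, b)` contained in the disc vanishes on the whole disc. -/
theorem eq_zero_of_eq_zero_on_real_Ioo {g : ℂ → ℂ} {e a b : ℝ}
    (hg : DifferentiableOn ℂ g (Metric.ball 0 e)) (ha : 0 ≤ a) (hab : a < b) (hb : b ≤ e)
    (h0 : ∀ s : ℝ, a < s → s < b → g s = 0) {t : ℂ} (ht : ‖t‖ < e) : g t = 0 := by
  obtain ⟨c, hac, hcb⟩ := exists_between hab
  have hcmem : (c : ℂ) ∈ Metric.ball (0 : ℂ) e := by
    rw [mem_ball_zero_iff, Complex.norm_real, Real.norm_eq_abs, abs_of_pos (by linarith)]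
    linarith
  have hfreq : ∃ᶠ w in nhdsWithin (c : ℂ) {(c : ℂ)}ᶜ, g w = 0 := by
    have htend : Filter.Tendsto (fun s : ℝ => (s : ℂ)) (nhdsWithin c {c}ᶜ)
        (nhdsWithin (c : ℂ) {(c : ℂ)}ᶜ) := by
      refine Complex.continuous_ofReal.continuousWithinAt.tendsto_nhdsWithin fun s hs => ?_
      simpa using hs
    refine htend.frequently (Filter.Eventually.frequently ?_)
    filter_upwards [nhdsWithin_le_nhds (Ioo_mem_nhds hac hcb)] with s hs
    exact h0 s hs.1 hs.2
  exact (hg.analyticOnNhd Metric.isOpen_ball).eqOn_zero_of_preconnected_of_frequently_eq_zero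
    (convex_ball (0 : ℂ) e).isPreconnected hcmem hfreq (mem_ball_zero_iff.2 ht)

/-- A function holomorphic on a bidisc which vanishes on the paraboloid `t = |z|²` vanishes. -/
theorem eq_zero_of_eq_zero_on_paraboloid {g : ℂ × ℂ → ℂ} {e : ℝ} (he : 0 < e) (he1 : e ≤ 1)
    (hg : DifferentiableOn ℂ g (Metric.ball 0 e ×ˢ Metric.ball 0 e))
    (h0 : ∀ z : ℂ, ‖z‖ < e → g (z, ((‖z‖ ^ 2 : ℝ) : ℂ)) = 0) {z t : ℂ}
    (hz : ‖z‖ < e) (ht : ‖t‖ < e) : g (z, t) = 0 := by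
  have hee : e ^ 2 ≤ e := by nlinarith
  have hgt : DifferentiableOn ℂ (fun t => g (z, t)) (Metric.ball 0 e) :=
    hg.comp (by fun_prop) fun t ht => ⟨mem_ball_zero_iff.2 hz, ht⟩
  refine eq_zero_of_eq_zero_on_real_Ioo hgt (sq_nonneg ‖z‖)
    (pow_lt_pow_left₀ hz (norm_nonneg z) two_ne_zero) hee (fun s hs hse => ?_) ht
  have hs0 : 0 < s := (sq_nonneg _).trans_lt hs
  have hr0 : 0 < √s := Real.sqrt_pos.2 hs0
  have hre : √s < e := (Real.sqrt_lt' he).2 hse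
  have hzr : ‖z‖ < √s := Real.lt_sqrt_of_sq_lt hs
  have hmaps : Set.MapsTo (fun w : ℂ => (w, (s : ℂ))) (Metric.ball 0 e)
      (Metric.ball 0 e ×ˢ Metric.ball 0 e) := fun w hw =>
    ⟨hw, by
      rw [mem_ball_zero_iff, Complex.norm_real, Real.norm_eq_abs, abs_of_pos hs0]
      linarith⟩
  have hgz : DifferentiableOn ℂ (fun w => g (w, (s : ℂ))) (Metric.ball 0 e) :=
    hg.comp (by fun_prop) hmaps
  have hdc : DiffContOnCl ℂ (fun w => g (w, (s : ℂ))) (Metric.ball 0 √s) := by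
    refine DifferentiableOn.diffContOnCl (hgz.mono ?_)
    rw [closure_ball _ hr0.ne']
    exact Metric.closedBall_subset_ball hre
  refine Complex.eqOn_of_eqOn_frontier (g := fun _ => 0) Metric.isBounded_ball hdc
    diffContOnCl_const (fun w hw => ?_) (mem_ball_zero_iff.2 hzr)
  rw [frontier_ball _ hr0.ne', mem_sphere_zero_iff_norm] at hw
  have := h0 w (hw ▸ hre)
  rwa [hw, Real.sq_sqrt hs0.le] at this


/-- If `f` is holomorphic near `0 ∈ ℂ³` and vanishes on the CR singular submanifold
`M = {(z, |z|⁴, |z|⁶)}` near the origin, then `f` vanishes on the intrinsic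
complexification `{w₁³ = w₂²}` in a neighborhood of the origin. -/
theorem stmt_10 (U : Set (ℂ × ℂ × ℂ)) (hU : IsOpen U)
    (hU0 : ((0 : ℂ), (0 : ℂ), (0 : ℂ)) ∈ U)
    (f : ℂ × ℂ × ℂ → ℂ) (hf : DifferentiableOn ℂ f U)
    (δ : ℝ) (hδ : 0 < δ)
    (hvan : ∀ z : ℂ, ‖z‖ < δ →
      (z, ((‖z‖ ^ 4 : ℝ) : ℂ), ((‖z‖ ^ 6 : ℝ) : ℂ)) ∈ U →
      f (z, ((‖z‖ ^ 4 : ℝ) : ℂ), ((‖z‖ ^ 6 : ℝ) : ℂ)) = 0) :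
    ∃ V : Set (ℂ × ℂ × ℂ), IsOpen V ∧ ((0 : ℂ), (0 : ℂ), (0 : ℂ)) ∈ V ∧ V ⊆ U ∧
      ∀ p ∈ V, p.2.1 ^ 3 = p.2.2 ^ 2 → f p = 0 := by
  obtain ⟨ε, hε, hball⟩ := Metric.isOpen_iff.1 hU _ hU0
  obtain ⟨e, he, hem⟩ : ∃ e, 0 < e ∧ e ≤ min ε (min δ 1) := ⟨_, by positivity, le_rfl⟩
  simp only [le_min_iff] at hem
  obtain ⟨heε, heδ, he1⟩ := hem
  have hmem : ∀ {a b c : ℂ}, ‖a‖ < e → ‖b‖ < e → ‖c‖ < e → (a, b, c) ∈ U := by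
    intro a b c ha hb hc
    apply hball
    simp only [Metric.mem_ball, Prod.dist_eq, dist_zero_right, max_lt_iff]
    exact ⟨by linarith, by linarith, by linarith⟩
  have hpow : ∀ {t : ℂ} {n : ℕ}, n ≠ 0 → ‖t‖ < e → ‖t ^ n‖ < e := by
    intro t n hn ht
    rw [norm_pow]
    exact (pow_le_of_le_one (norm_nonneg t) (by linarith) hn).trans_lt ht
  have hg : DifferentiableOn ℂ (fun q : ℂ × ℂ => f (q.1, q.2 ^ 2, q.2 ^ 3))
      (Metric.ball 0 e ×ˢ Metric.ball 0 e) := by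
    refine hf.comp (by fun_prop) fun q hq => ?_
    have h1 := mem_ball_zero_iff.1 hq.1
    have h2 := mem_ball_zero_iff.1 hq.2
    exact hmem h1 (hpow two_ne_zero h2) (hpow three_ne_zero h2)
  have hpar : ∀ z : ℂ, ‖z‖ < e →
      f (z, ((‖z‖ ^ 2 : ℝ) : ℂ) ^ 2, ((‖z‖ ^ 2 : ℝ) : ℂ) ^ 3) = 0 := by
    intro z hz
    have hn : ‖((‖z‖ : ℝ) : ℂ)‖ < e := by simpa using hz
    have := hvan z (by linarith) (hmem hz
      (by simpa using hpow (n := 4) (by norm_num) hn)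
      (by simpa using hpow (n := 6) (by norm_num) hn))
    rw [← Complex.ofReal_pow, ← Complex.ofReal_pow, ← pow_mul, ← pow_mul]
    exact this
  refine ⟨Metric.ball 0 e ×ˢ Metric.ball 0 (e ^ 2) ×ˢ Metric.ball 0 e,
    Metric.isOpen_ball.prod (Metric.isOpen_ball.prod Metric.isOpen_ball), ?_, ?_, ?_⟩
  · simp [he]
  · rintro ⟨z, w₁, w₂⟩ ⟨hz, hw₁, hw₂⟩
    simp only [mem_ball_zero_iff] at hz hw₁ hw₂
    exact hmem hz (by nlinarith) hw₂
  · rintro ⟨z, w₁, w₂⟩ ⟨hz, hw₁, -⟩ hw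
    simp only [mem_ball_zero_iff] at hz hw₁ hw
    obtain ⟨t, rfl, rfl⟩ : ∃ t : ℂ, t ^ 2 = w₁ ∧ t ^ 3 = w₂ := by
      rcases eq_or_ne w₁ 0 with rfl | h
      · have : w₂ = 0 := by simpa using hw.symm
        exact ⟨0, by simp [this]⟩
      · refine ⟨w₂ / w₁, ?_, ?_⟩
        · rw [div_pow, ← hw]
          field_simp
        · rw [div_pow, hw]
          have : w₂ ≠ 0 := by
            rintro rfl
            simp [h] at hw
          field_simp
    rw [norm_pow] at hw₁
    exact eq_zero_of_eq_zero_on_paraboloid he he1 hg hpar hz (lt_of_pow_lt_pow_left₀ 2 he.le hw₁)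
end

section
/- If U ⊆ ℂ² is an open neighborhood of the origin and f : U → ℂ is a holomorphic function such that f(z, |z|²) = 0 for all z ∈ ℂ of sufficiently small modulus (where |z|² is viewed as a complex number with zero imaginary part), then f vanishes identically on some neighborhood of the origin in ℂ². -/
open Filter Topology Metric in
/-- A holomorphic function on a disc vanishing on a circle inside the disc vanishes. -/
theorem eq_zero_of_forall_norm_eq {g : ℂ → ℂ} {r s : ℝ} (hg : DifferentiableOn ℂ g (ball 0 r))
    (hs : 0 < s) (hsr : s < r) (h : ∀ z : ℂ, ‖z‖ = s → g z = 0) :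
    Set.EqOn g 0 (ball 0 r) := by
  have hs_mem : (s : ℂ) ∈ ball (0 : ℂ) r := by simpa [abs_of_pos hs] using hsr
  refine (hg.analyticOnNhd isOpen_ball).eqOn_zero_of_preconnected_of_frequently_eq_zero
    (convex_ball _ _).isPreconnected hs_mem ?_
  have htend : Tendsto (fun θ : ℝ => (s : ℂ) * Complex.exp (θ * Complex.I)) (𝓝 0) (𝓝 (s : ℂ)) := by
    have : Continuous fun θ : ℝ => (s : ℂ) * Complex.exp (θ * Complex.I) := by fun_prop
    simpa using this.tendsto 0
  have htend' : Tendsto (fun θ : ℝ => (s : ℂ) * Complex.exp (θ * Complex.I)) (𝓝[>] 0)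
      (𝓝[≠] (s : ℂ)) := by
    refine tendsto_nhdsWithin_iff.2 ⟨htend.mono_left nhdsWithin_le_nhds, ?_⟩
    filter_upwards [Ioo_mem_nhdsGT Real.pi_pos] with θ hθ heq
    have him := congrArg Complex.im heq
    rw [Complex.im_ofReal_mul, Complex.exp_ofReal_mul_I_im, Complex.ofReal_im] at him
    exact (mul_pos hs (Real.sin_pos_of_mem_Ioo hθ)).ne' him
  refine htend'.frequently (Eventually.frequently (Eventually.of_forall fun θ => h _ ?_))
  simp [Complex.norm_exp_ofReal_mul_I, abs_of_pos hs]

open Filter Topology Metric in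
/-- A holomorphic function on a disc vanishing at all small positive reals vanishes. -/
theorem eq_zero_of_forall_ofReal {g : ℂ → ℂ} {r ε : ℝ} (hg : DifferentiableOn ℂ g (ball 0 r))
    (hr : 0 < r) (hε : 0 < ε) (h : ∀ t : ℝ, 0 < t → t < ε → g t = 0) :
    Set.EqOn g 0 (ball 0 r) := by
  refine (hg.analyticOnNhd isOpen_ball).eqOn_zero_of_preconnected_of_frequently_eq_zero
    (convex_ball _ _).isPreconnected (mem_ball_self hr) ?_
  have htend : Tendsto (fun t : ℝ => (t : ℂ)) (𝓝[>] 0) (𝓝[≠] (0 : ℂ)) := by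
    refine tendsto_nhdsWithin_iff.2 ⟨?_, ?_⟩
    · simpa using (Complex.continuous_ofReal.tendsto 0).mono_left nhdsWithin_le_nhds
    · filter_upwards [self_mem_nhdsWithin] with t ht
      simpa using (ne_of_gt ht)
  refine htend.frequently (Eventually.frequently ?_)
  filter_upwards [Ioo_mem_nhdsGT hε] with t ht using h t ht.1 ht.2


/-- If `f` is holomorphic near `0 ∈ ℂ²` and vanishes on the CR singular submanifold
`M = {(z, |z|²)}` near the origin, then `f` vanishes identically on a neighborhood of
the origin: `M` is ICgeneric at `0` even though its tangent plane there is complex. -/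
theorem stmt_11 (U : Set (ℂ × ℂ)) (hU : IsOpen U) (hU0 : ((0 : ℂ), (0 : ℂ)) ∈ U)
    (f : ℂ × ℂ → ℂ) (hf : DifferentiableOn ℂ f U)
    (δ : ℝ) (hδ : 0 < δ)
    (hvan : ∀ z : ℂ, ‖z‖ < δ → (z, ((‖z‖ ^ 2 : ℝ) : ℂ)) ∈ U →
      f (z, ((‖z‖ ^ 2 : ℝ) : ℂ)) = 0) :
    ∃ V : Set (ℂ × ℂ), IsOpen V ∧ ((0 : ℂ), (0 : ℂ)) ∈ V ∧ V ⊆ U ∧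
      ∀ p ∈ V, f p = 0 := by
  obtain ⟨r, hr, hrU⟩ := Metric.isOpen_iff.1 hU _ hU0
  rw [← ball_prod_same] at hrU
  refine ⟨Metric.ball 0 r ×ˢ Metric.ball 0 r, Metric.isOpen_ball.prod Metric.isOpen_ball,
    ⟨Metric.mem_ball_self hr, Metric.mem_ball_self hr⟩, hrU, ?_⟩
  have hslice : ∀ t : ℝ, 0 < t → t < min r (min (r ^ 2) (δ ^ 2)) →
      Set.EqOn (fun z => f (z, (t : ℂ))) 0 (Metric.ball 0 r) := by
    intro t ht htlt
    obtain ⟨htr, htr2, htδ2⟩ : t < r ∧ t < r ^ 2 ∧ t < δ ^ 2 := by simpa using htlt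
    have ht_mem : (t : ℂ) ∈ Metric.ball (0 : ℂ) r := by simpa [abs_of_pos ht] using htr
    have hsr : √t < r := (Real.sqrt_lt' hr).2 htr2
    refine eq_zero_of_forall_norm_eq (s := √t) ?_ (Real.sqrt_pos.2 ht) hsr ?_
    · exact hf.comp (by fun_prop) fun z hz => hrU ⟨hz, ht_mem⟩
    · intro z hz
      have hsq : ‖z‖ ^ 2 = t := by rw [hz, Real.sq_sqrt ht.le]
      have hv := hvan z (hz ▸ (Real.sqrt_lt' hδ).2 htδ2)
      rw [hsq] at hv
      exact hv (hrU ⟨by simpa [hz] using hsr, ht_mem⟩)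
  rintro ⟨z, w⟩ ⟨hz, hw⟩
  refine eq_zero_of_forall_ofReal (g := fun w => f (z, w)) (ε := min r (min (r ^ 2) (δ ^ 2)))
    ?_ hr (by positivity) (fun t ht htlt => hslice t ht htlt hz) hw
  exact hf.comp (by fun_prop) fun w hw => hrU ⟨hz, hw⟩
end

section
/- Let λ be an irrational real number and suppose f(z, w₁, w₂) = ∑_{j,k,ℓ} c_{jkℓ}·z^j·w₁^k·w₂^ℓ is a power series with complex coefficients converging on a polydisc around 0 ∈ ℂ³ such that f(z, z·e^{z·conj(z)}, z·e^{λ·z·conj(z)}) = 0 for all sufficiently small z ∈ ℂ. Then for every d ∈ ℕ and every sufficiently small r ≥ 0, one has ∑_{j+k+ℓ=d} c_{jkℓ}·e^{(k + λℓ)·r²} = 0. -/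
/-- A power series converging absolutely at radius `ρ` and vanishing on a circle of smaller
positive radius has all its coefficients equal to zero. -/
theorem coeff_eq_zero_of_tsum_eq_zero_on_circle (a : ℕ → ℂ) {r ρ : ℝ} (hr : 0 < r)
    (hrρ : r < ρ) (hs : Summable fun n => ‖a n‖ * ρ ^ n)
    (h0 : ∀ z : ℂ, ‖z‖ = r → ∑' n, a n * z ^ n = 0) (n : ℕ) : a n = 0 := by
  have hρ : 0 < ρ := hr.trans hrρ
  lift ρ to NNReal using hρ.le
  have hrad : (ρ : ENNReal) ≤ (FormalMultilinearSeries.ofScalars ℂ a).radius :=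
    FormalMultilinearSeries.le_radius_of_summable _
      (by simpa [FormalMultilinearSeries.ofScalars_norm] using hs)
  have hps : HasFPowerSeriesOnBall (fun z : ℂ => ∑' n, a n * z ^ n)
      (FormalMultilinearSeries.ofScalars ℂ a) 0 ρ := by
    refine ⟨hrad, by exact_mod_cast hρ, fun {y} hy => ?_⟩
    have hy' : ‖y‖ < ρ := by simpa using hy
    have hsum : Summable fun n => a n * y ^ n := by
      refine Summable.of_norm_bounded hs fun n => ?_
      rw [norm_mul, norm_pow]
      gcongr
    simpa [FormalMultilinearSeries.ofScalars_apply_eq, smul_eq_mul, mul_comm] using hsum.hasSum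
  have hd : DifferentiableOn ℂ (fun z : ℂ => ∑' n, a n * z ^ n) (Metric.ball 0 ρ) := by
    simpa [Metric.eball_coe] using hps.differentiableOn
  have hdc : DiffContOnCl ℂ (fun z : ℂ => ∑' n, a n * z ^ n) (Metric.ball 0 r) :=
    (hd.mono ((Metric.closure_ball_subset_closedBall).trans
      (Metric.closedBall_subset_ball hrρ))).diffContOnCl
  have heq : Set.EqOn (fun z : ℂ => ∑' n, a n * z ^ n) (fun _ => 0)
      (closure (Metric.ball 0 r)) := by
    refine Complex.eqOn_closure_of_eqOn_frontier Metric.isBounded_ball hdc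
      diffContOnCl_const fun z hz => ?_
    rw [frontier_ball _ hr.ne'] at hz
    exact h0 z (by simpa using hz)
  have hev : (fun z : ℂ => ∑' n, a n * z ^ n) =ᶠ[nhds 0] 0 := by
    filter_upwards [Metric.ball_mem_nhds (0 : ℂ) hr] with z hz using heq (subset_closure hz)
  have hz : FormalMultilinearSeries.ofScalars ℂ a = 0 :=
    (hps.hasFPowerSeriesAt.congr hev).eq_zero
  exact congrFun ((FormalMultilinearSeries.ofScalars_series_eq_zero ℂ).1 hz) n

/-- Grouping a summable family indexed by exponent triples by total degree. -/
theorem hasSum_degree_fiberwise {f : ℕ × ℕ × ℕ → ℂ} {s : ℂ} (hf : HasSum f s) :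
    HasSum (fun d : ℕ => ∑ p ∈ (Finset.range (d + 1) ×ˢ Finset.range (d + 1) ×ˢ
      Finset.range (d + 1)).filter (fun p : ℕ × ℕ × ℕ => p.1 + p.2.1 + p.2.2 = d), f p) s := by
  refine (congrArg (HasSum · s) (funext fun d => ?_)).mpr
    (hf.tsum_fiberwise fun p : ℕ × ℕ × ℕ => p.1 + p.2.1 + p.2.2)
  rw [← Finset.tsum_subtype']
  have hset : (((Finset.range (d + 1) ×ˢ Finset.range (d + 1) ×ˢ
      Finset.range (d + 1)).filter (fun p : ℕ × ℕ × ℕ => p.1 + p.2.1 + p.2.2 = d) :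
        Finset (ℕ × ℕ × ℕ)) : Set (ℕ × ℕ × ℕ)) =
      (fun p : ℕ × ℕ × ℕ => p.1 + p.2.1 + p.2.2) ⁻¹' {d} := by
    ext p
    simp only [Finset.coe_filter, Finset.mem_product, Finset.mem_range, Set.mem_ofPred_eq,
      Set.mem_preimage, Set.mem_singleton_iff]
    omega
  rw [hset]



/-- If `λ` is irrational and the power series `f = ∑ c_{jkℓ} z^j w₁^k w₂^ℓ`, convergent
on a polydisc around `0 ∈ ℂ³`, vanishes on `M_λ = {(z, z e^{z z̄}, z e^{λ z z̄})}` for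
small `z`, then each homogeneous-degree coefficient sum `∑_{j+k+ℓ=d} c_{jkℓ} e^{(k+λℓ)r²}`
vanishes for small `r ≥ 0`. -/
theorem stmt_13 (lam : ℝ) (hlam : Irrational lam)
    (c : ℕ × ℕ × ℕ → ℂ) (R : ℝ) (hR : 0 < R)
    (hconv : ∀ z w₁ w₂ : ℂ, ‖z‖ < R → ‖w₁‖ < R → ‖w₂‖ < R →
      Summable (fun p : ℕ × ℕ × ℕ => c p * z ^ p.1 * w₁ ^ p.2.1 * w₂ ^ p.2.2))
    (δ : ℝ) (hδ : 0 < δ)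
    (hvan : ∀ z : ℂ, ‖z‖ < δ →
      ∑' p : ℕ × ℕ × ℕ,
        c p * z ^ p.1 * (z * Complex.exp (z * (starRingEnd ℂ) z)) ^ p.2.1 *
          (z * Complex.exp ((lam : ℂ) * (z * (starRingEnd ℂ) z))) ^ p.2.2 = 0) :
    ∀ d : ℕ, ∃ r₀ : ℝ, 0 < r₀ ∧ ∀ r : ℝ, 0 ≤ r → r < r₀ →
      ∑ p ∈ (Finset.range (d + 1) ×ˢ Finset.range (d + 1) ×ˢ
          Finset.range (d + 1)).filter
          (fun p : ℕ × ℕ × ℕ => p.1 + p.2.1 + p.2.2 = d),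
        c p * Complex.exp (((((p.2.1 : ℝ) + lam * (p.2.2 : ℝ)) * r ^ 2 : ℝ)) : ℂ) = 0 := by
  intro d
  have hcont (μ : ℝ) : ∀ᶠ r : ℝ in nhds 0, 2 * r * Real.exp (μ * r ^ 2) < R := by
    have : Continuous fun r : ℝ => 2 * r * Real.exp (μ * r ^ 2) := by fun_prop
    exact this.tendsto' 0 0 (by simp) |>.eventually_lt_const hR
  obtain ⟨r₀, hr₀, hball⟩ := Metric.eventually_nhds_iff.1
    ((hcont 0).and ((hcont 1).and ((hcont lam).and (eventually_lt_nhds hδ))))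
  have hpos : ∀ r ∈ Set.Ioo 0 r₀, ∑ p ∈ (Finset.range (d + 1) ×ˢ Finset.range (d + 1) ×ˢ
          Finset.range (d + 1)).filter (fun p : ℕ × ℕ × ℕ => p.1 + p.2.1 + p.2.2 = d),
        c p * Complex.exp (((((p.2.1 : ℝ) + lam * (p.2.2 : ℝ)) * r ^ 2 : ℝ)) : ℂ) = 0 := by
    rintro r ⟨hr, hrr₀⟩
    obtain ⟨h2r, h1, hl, hrδ⟩ := hball (y := r) (by simpa [abs_of_pos hr] using hrr₀)
    have hterm (z : ℂ) (p : ℕ × ℕ × ℕ) :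
        c p * z ^ p.1 * (z * Complex.exp ((r ^ 2 : ℝ) : ℂ)) ^ p.2.1 *
          (z * Complex.exp ((lam : ℂ) * ((r ^ 2 : ℝ) : ℂ))) ^ p.2.2 =
        c p * Complex.exp (((((p.2.1 : ℝ) + lam * (p.2.2 : ℝ)) * r ^ 2 : ℝ)) : ℂ) *
          z ^ (p.1 + p.2.1 + p.2.2) := by
      have : Complex.exp (((((p.2.1 : ℝ) + lam * (p.2.2 : ℝ)) * r ^ 2 : ℝ)) : ℂ) =
          Complex.exp ((r ^ 2 : ℝ) : ℂ) ^ p.2.1 *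
            Complex.exp ((lam : ℂ) * ((r ^ 2 : ℝ) : ℂ)) ^ p.2.2 := by
        rw [← Complex.exp_nat_mul, ← Complex.exp_nat_mul, ← Complex.exp_add]
        push_cast
        ring_nf
      rw [this]
      ring
    have hsummable (z : ℂ) (hz : ‖z‖ ≤ 2 * r) : Summable fun p : ℕ × ℕ × ℕ =>
        c p * z ^ p.1 * (z * Complex.exp ((r ^ 2 : ℝ) : ℂ)) ^ p.2.1 *
          (z * Complex.exp ((lam : ℂ) * ((r ^ 2 : ℝ) : ℂ))) ^ p.2.2 := by
      refine hconv _ _ _ (hz.trans_lt (by simpa using h2r)) ?_ ?_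
      · rw [norm_mul, ← Complex.ofReal_exp, Complex.norm_of_nonneg (Real.exp_pos _).le]
        rw [one_mul] at h1
        exact (by gcongr : _ ≤ _).trans_lt h1
      · rw [norm_mul, ← Complex.ofReal_mul, ← Complex.ofReal_exp,
          Complex.norm_of_nonneg (Real.exp_pos _).le]
        exact (by gcongr : _ ≤ _).trans_lt hl
    have hgroup (z : ℂ) (hz : ‖z‖ ≤ 2 * r) := hasSum_degree_fiberwise (hsummable z hz).hasSum
    have hfiber (z : ℂ) (n : ℕ) :
        ∑ p ∈ (Finset.range (n + 1) ×ˢ Finset.range (n + 1) ×ˢ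
          Finset.range (n + 1)).filter (fun p : ℕ × ℕ × ℕ => p.1 + p.2.1 + p.2.2 = n),
          c p * z ^ p.1 * (z * Complex.exp ((r ^ 2 : ℝ) : ℂ)) ^ p.2.1 *
            (z * Complex.exp ((lam : ℂ) * ((r ^ 2 : ℝ) : ℂ))) ^ p.2.2 =
        (∑ p ∈ (Finset.range (n + 1) ×ˢ Finset.range (n + 1) ×ˢ
          Finset.range (n + 1)).filter (fun p : ℕ × ℕ × ℕ => p.1 + p.2.1 + p.2.2 = n),
          c p * Complex.exp (((((p.2.1 : ℝ) + lam * (p.2.2 : ℝ)) * r ^ 2 : ℝ)) : ℂ)) *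
          z ^ n := by
      rw [Finset.sum_mul]
      refine Finset.sum_congr rfl fun p hp => ?_
      rw [hterm, (Finset.mem_filter.1 hp).2]
    simp only [hfiber] at hgroup
    refine coeff_eq_zero_of_tsum_eq_zero_on_circle
      (fun n => ∑ p ∈ (Finset.range (n + 1) ×ˢ Finset.range (n + 1) ×ˢ
          Finset.range (n + 1)).filter (fun p : ℕ × ℕ × ℕ => p.1 + p.2.1 + p.2.2 = n),
          c p * Complex.exp (((((p.2.1 : ℝ) + lam * (p.2.2 : ℝ)) * r ^ 2 : ℝ)) : ℂ))
      (ρ := 2 * r) hr (by linarith) ?_ (fun z hz => ?_) d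
    · have hn : ‖((2 * r : ℝ) : ℂ)‖ = 2 * r := Complex.norm_of_nonneg (by positivity)
      have := (hgroup ((2 * r : ℝ) : ℂ) hn.le).summable.norm
      simpa only [norm_mul, norm_pow, hn] using this
    · rw [(hgroup z (by linarith)).tsum_eq]
      have hzz : z * (starRingEnd ℂ) z = ((r ^ 2 : ℝ) : ℂ) := by
        rw [Complex.mul_conj, Complex.normSq_eq_norm_sq, hz]
      have := hvan z (by rw [hz]; exact hrδ)
      rwa [hzz] at this
  refine ⟨r₀, hr₀, fun r hr hrr₀ => ?_⟩
  have hmem : r ∈ closure (Set.Ioo 0 r₀) := by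
    rw [closure_Ioo hr₀.ne]
    exact ⟨hr, hrr₀.le⟩
  exact Set.EqOn.closure (g := fun _ => (0 : ℂ)) hpos (by fun_prop) continuous_const hmem
end
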